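/- Let R^3 be the profile ≽_1: a,c,{b,d}; ≽_2: {b,d},a,c; ≽_3: a,d,{b,c}; ≽_4: {b,c},a,d. Then f(R^3)(a) ≤ 1/2, and hence f(R^3)(a) + f(R^3)(c) ≤ 1/2. -/

import Mathlib

open Finset
open scoped Classical

section Framework

variable {A : Type*} [Fintype A] {n : ℕ}

/-- `p` is a lottery (probability distribution) on the set of alternatives `A`. -/
def IsLottery (p : A → ℝ) : Prop := (∀ x, 0 ≤ p x) ∧ ∑ x, p x = 1

/-- `r` is a weak preference relation: complete (total) and transitive. -/
def IsPref (r : A → A → Prop) : Prop := Total r ∧ Transitive r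

/-- A preference profile assigns a weak preference relation to each of the `n` agents. -/
def IsProfile (R : Fin n → A → A → Prop) : Prop := ∀ i, IsPref (R i)

/-- The probability that `p` assigns to alternatives weakly preferred (by `r`) to `x`. -/
noncomputable def upperProb (r : A → A → Prop) (p : A → ℝ) (x : A) : ℝ :=
  ∑ y ∈ univ.filter (fun y => r y x), p y

/-- Stochastic dominance: `p ≽^sd q` w.r.t. the preference relation `r`. -/
def SDge (r : A → A → Prop) (p q : A → ℝ) : Prop :=
  ∀ x, upperProb r q x ≤ upperProb r p x

/-- Strict stochastic dominance: `p ≻^sd q` w.r.t. the preference relation `r`. -/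
def SDgt (r : A → A → Prop) (p q : A → ℝ) : Prop :=
  SDge r p q ∧ ¬ SDge r q p

/-- A social decision scheme maps every preference profile to a lottery. -/
def IsSDS (f : (Fin n → A → A → Prop) → (A → ℝ)) : Prop :=
  ∀ R : Fin n → A → A → Prop, IsProfile R → IsLottery (f R)

/-- Anonymity: invariance under permutations of the agents. -/
def Anonymous (f : (Fin n → A → A → Prop) → (A → ℝ)) : Prop :=
  ∀ R : Fin n → A → A → Prop, IsProfile R → ∀ π : Equiv.Perm (Fin n),
    f (fun i => R (π i)) = f R

/-- Neutrality: `f(R^σ)(σ x) = f(R)(x)`, where `R^σ` relabels alternatives by `σ`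
(i.e. `σ x ≽^σ_i σ y ↔ x ≽_i y`). -/
def Neutral (f : (Fin n → A → A → Prop) → (A → ℝ)) : Prop :=
  ∀ R : Fin n → A → A → Prop, IsProfile R → ∀ σ : Equiv.Perm A, ∀ x : A,
    f (fun i u v => R i (σ.symm u) (σ.symm v)) (σ x) = f R x

/-- The lottery `p` is sd-efficient for the profile `R`: no lottery `q` is weakly
sd-preferred to `p` by all agents and strictly sd-preferred by some agent. -/
def SDEfficientLottery (R : Fin n → A → A → Prop) (p : A → ℝ) : Prop :=
  ¬ ∃ q : A → ℝ, IsLottery q ∧ (∀ i, SDge (R i) q p) ∧ (∃ i, SDgt (R i) q p)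

/-- sd-efficiency of a social decision scheme. -/
def SDEfficient (f : (Fin n → A → A → Prop) → (A → ℝ)) : Prop :=
  ∀ R : Fin n → A → A → Prop, IsProfile R → SDEfficientLottery R (f R)

/-- sd-strategyproofness: no agent can misreport and obtain a strictly
sd-preferred lottery. -/
def SDStrategyproof (f : (Fin n → A → A → Prop) → (A → ℝ)) : Prop :=
  ∀ R R' : Fin n → A → A → Prop, IsProfile R → IsProfile R' → ∀ i : Fin n,
    (∀ j, j ≠ i → R j = R' j) → ¬ SDgt (R i) (f R') (f R)

/-- `x` is the unique most-preferred alternative of the relation `r`. -/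
def UniqueTop (r : A → A → Prop) (x : A) : Prop :=
  ∀ y, y ≠ x → r x y ∧ ¬ r y x

/-- `f` extends random dictatorship: whenever every agent has a unique top choice,
each alternative gets probability (number of agents having it as top)/n. -/
def ExtendsRD (f : (Fin n → A → A → Prop) → (A → ℝ)) : Prop :=
  ∀ R : Fin n → A → A → Prop, IsProfile R →
    ∀ t : Fin n → A, (∀ i, UniqueTop (R i) (t i)) →
      ∀ x : A, f R x = ((univ.filter (fun i => t i = x)).card : ℝ) / (n : ℝ)

/-- `x` is Pareto-dominated in the profile `R`. -/
def Pareto_Dominated (R : Fin n → A → A → Prop) (x : A) : Prop :=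
  ∃ y : A, (∀ i, R i y x) ∧ ∃ i, R i y x ∧ ¬ R i x y

end Framework

/-! Concrete setting: alternatives `A = {a,b,c,d}` encoded as `Fin 4`. -/

/-- The alternative `a`. -/ def a : Fin 4 := 0
/-- The alternative `b`. -/ def b : Fin 4 := 1
/-- The alternative `c`. -/ def c : Fin 4 := 2
/-- The alternative `d`. -/ def d : Fin 4 := 3

/-- The weak preference relation induced by a rank function over `(a,b,c,d)`
(lower rank = more preferred; equal ranks = indifference). -/
def pr (rk : Fin 4 → ℕ) : Fin 4 → Fin 4 → Prop := fun x y => rk x ≤ rk y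


/-- The profile `R3`: ≽₁: a,c,{b,d}; ≽₂: {b,d},a,c; ≽₃: a,d,{b,c}; ≽₄: {b,c},a,d. -/
def R3 : Fin 4 → Fin 4 → Fin 4 → Prop :=
  ![pr ![0,2,1,2], pr ![1,0,2,0], pr ![0,2,2,1], pr ![1,0,0,2]]

section Efficiency

variable {A : Type*} [Fintype A] {n : ℕ}

theorem upperProb_add (r : A → A → Prop) (p q : A → ℝ) (x : A) :
    upperProb r (p + q) x = upperProb r p x + upperProb r q x := by
  simp [upperProb, sum_add_distrib]

/-- An sd-efficient lottery admits no feasible shift of probability that weakly raises every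
agent's upper probabilities and raises one of them strictly. -/
theorem SDEfficientLottery.not_improvable {R : Fin n → A → A → Prop} {p v : A → ℝ}
    (heff : SDEfficientLottery R p) (hp : IsLottery p) (hv : ∑ x, v x = 0)
    (hpos : ∀ x, 0 ≤ p x + v x) (hge : ∀ i x, 0 ≤ upperProb (R i) v x) (i : Fin n) (x : A) :
    upperProb (R i) v x ≤ 0 := by
  by_contra! hgt
  have hsd : ∀ j, SDge (R j) (p + v) p := fun j y => by
    rw [upperProb_add]
    linarith [hge j y]
  refine heff ⟨p + v, ⟨hpos, ?_⟩, hsd, i, hsd i, fun h => ?_⟩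
  · simp [sum_add_distrib, hp.2, hv]
  · have := h x
    rw [upperProb_add] at this
    linarith

theorem SDEfficientLottery.eq_zero_of_dominated {R : Fin n → A → A → Prop} {p : A → ℝ}
    (heff : SDEfficientLottery R p) (hp : IsLottery p) (hR : IsProfile R) {x : A}
    (hx : Pareto_Dominated R x) : p x = 0 := by
  obtain ⟨y, hy, i, -, hi⟩ := hx
  set v : A → ℝ := p x • (Pi.single y 1 - Pi.single x 1) with hv
  have hup : ∀ j z, upperProb (R j) v z =
      p x * ((if R j y z then 1 else 0) - if R j x z then 1 else 0) := fun j z => by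
    simp [upperProb, hv, ← mul_sum, sum_sub_distrib, Pi.single_apply]
  have hxy : y ≠ x := by
    rintro rfl
    exact hi (hy i)
  have key := heff.not_improvable (v := v) hp ?_ (fun z => ?_) (fun j z => ?_) i y
  · rw [hup, if_pos ((hR i).1 y y |>.elim id id), if_neg hi] at key
    linarith [hp.1 x]
  · simp [hv, ← mul_sum, sum_sub_distrib]
  · have h1 := hp.1 z
    have h2 := hp.1 x
    by_cases hzy : z = y
    · subst hzy
      simp [hv, hxy]
      linarith
    · by_cases hzx : z = x
      · subst hzx
        simp [hv, hzy]
      · simpa [hv, hzy, hzx] using h1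
  · rw [hup]
    refine mul_nonneg (hp.1 x) ?_
    by_cases h : R j x z
    · simp [h, (hR j).2 (hy j) h]
    · simp only [h, if_false]
      split_ifs <;> norm_num

/-- Under sd-strategyproofness, a misreport that is weakly sd-preferred is sd-equivalent. -/
theorem SDStrategyproof.sdge {f : (Fin n → A → A → Prop) → (A → ℝ)} (hsp : SDStrategyproof f)
    {R R' : Fin n → A → A → Prop} (hR : IsProfile R) (hR' : IsProfile R') (i : Fin n)
    (h : ∀ j, j ≠ i → R j = R' j) (hge : SDge (R i) (f R') (f R)) :
    SDge (R i) (f R) (f R') := by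
  by_contra hn
  exact hsp R R' hR hR' i h ⟨hge, hn⟩

end Efficiency

/-- The profile in which each agent's preferences are given by a rank function. -/
def rankProfile (rk : Fin 4 → Fin 4 → ℕ) : Fin 4 → Fin 4 → Fin 4 → Prop := fun i => pr (rk i)

theorem isProfile_rankProfile (rk : Fin 4 → Fin 4 → ℕ) : IsProfile (rankProfile rk) :=
  fun _ => ⟨fun _ _ => le_total _ _, fun _ _ _ => le_trans⟩

theorem IsLottery.add_eq_one {p : Fin 4 → ℝ} (hp : IsLottery p) : p 0 + p 1 + p 2 + p 3 = 1 := by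
  rw [← hp.2, Fin.sum_univ_four]

theorem upperProb_pr (rk : Fin 4 → ℕ) (p : Fin 4 → ℝ) (x : Fin 4) :
    upperProb (pr rk) p x = (if rk 0 ≤ rk x then p 0 else 0) + (if rk 1 ≤ rk x then p 1 else 0) +
      (if rk 2 ≤ rk x then p 2 else 0) + if rk 3 ≤ rk x then p 3 else 0 := by
  rw [upperProb, sum_filter, Fin.sum_univ_four]
  congr!

/-- Anonymity and neutrality: a relabelling of alternatives that acts on the profile as a
permutation of agents preserves the chosen lottery. -/
theorem apply_rankProfile_symm {f : (Fin 4 → Fin 4 → Fin 4 → Prop) → (Fin 4 → ℝ)}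
    (han : Anonymous f) (hneu : Neutral f) (rk : Fin 4 → Fin 4 → ℕ) (σ π : Equiv.Perm (Fin 4))
    (h : ∀ i, rk i ∘ σ.symm = rk (π i)) (x : Fin 4) :
    f (rankProfile rk) (σ x) = f (rankProfile rk) x := by
  have h1 := hneu _ (isProfile_rankProfile rk) σ x
  have h2 := han _ (isProfile_rankProfile rk) π
  have h3 : (fun i u v => rankProfile rk i (σ.symm u) (σ.symm v)) =
      fun i => rankProfile rk (π i) := funext fun i => congrArg pr (h i)
  rwa [h3, h2] at h1

/-- The probability of the first alternative does not decrease when an agent reports it as the only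
preferred alternative, being indifferent between the others. -/
theorem SDStrategyproof.le_of_top {f : (Fin 4 → Fin 4 → Fin 4 → Prop) → (Fin 4 → ℝ)}
    (hf : IsSDS f) (hsp : SDStrategyproof f) (rk : Fin 4 → Fin 4 → ℕ) (i : Fin 4) :
    f (rankProfile rk) 0 ≤ f (rankProfile (Function.update rk i ![0, 1, 1, 1])) 0 := by
  have s1 := (hf _ (isProfile_rankProfile rk)).add_eq_one
  have s2 := (hf _ (isProfile_rankProfile (Function.update rk i ![0, 1, 1, 1]))).add_eq_one
  by_contra! hlt
  have hi : rankProfile (Function.update rk i ![0, 1, 1, 1]) i = pr ![0, 1, 1, 1] := by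
    simp [rankProfile]
  have key := hsp.sdge (isProfile_rankProfile (Function.update rk i ![0, 1, 1, 1]))
    (isProfile_rankProfile rk) i (fun j hj => by simp [rankProfile, hj]) ?_ 0
  · rw [hi] at key
    simp [upperProb_pr] at key
    linarith
  · rw [hi]
    intro x
    fin_cases x <;> simp [upperProb_pr] <;> linarith

/-- When only the first two alternatives are chosen with positive probability, an agent who prefers
the second one cannot raise its probability by a misreport. -/
theorem SDStrategyproof.apply_one_le {f : (Fin 4 → Fin 4 → Fin 4 → Prop) → (Fin 4 → ℝ)}
    (hf : IsSDS f) (hsp : SDStrategyproof f) {rk rk' : Fin 4 → Fin 4 → ℕ} (i : Fin 4)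
    (h : ∀ j, j ≠ i → rk j = rk' j) (hpref : rk i 1 < rk i 0)
    (h2 : f (rankProfile rk) 2 = 0) (h3 : f (rankProfile rk) 3 = 0)
    (h2' : f (rankProfile rk') 2 = 0) (h3' : f (rankProfile rk') 3 = 0) :
    f (rankProfile rk') 1 ≤ f (rankProfile rk) 1 := by
  have hs := (hf _ (isProfile_rankProfile rk)).add_eq_one
  have hs' := (hf _ (isProfile_rankProfile rk')).add_eq_one
  by_contra! hlt
  have key := hsp.sdge (isProfile_rankProfile rk) (isProfile_rankProfile rk') i
    (fun j hj => congrArg pr (h j hj)) (fun x => ?_) 1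
  · change upperProb (pr (rk i)) _ 1 ≤ upperProb (pr (rk i)) _ 1 at key
    simp only [upperProb_pr, h2, h3, h2', h3', not_le.2 hpref, le_refl, if_true, if_false,
      ite_self] at key
    linarith
  · change upperProb (pr (rk i)) _ x ≤ upperProb (pr (rk i)) _ x
    simp only [upperProb_pr, h2, h3, h2', h3', ite_self]
    by_cases h0 : rk i 0 ≤ rk i x
    · rw [if_pos h0, if_pos (hpref.le.trans h0), if_pos h0, if_pos (hpref.le.trans h0)]
      linarith
    · rw [if_neg h0, if_neg h0]
      split_ifs <;> linarith

/-- Efficiency for `R3`, by symmetry in the alternatives `c` and `d`. -/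
theorem apply_R3_c_eq_zero {f : (Fin 4 → Fin 4 → Fin 4 → Prop) → (Fin 4 → ℝ)}
    (hf : IsSDS f) (han : Anonymous f) (hneu : Neutral f) (heff : SDEfficient f) :
    f (rankProfile ![![0, 2, 1, 2], ![1, 0, 2, 0], ![0, 2, 2, 1], ![1, 0, 0, 2]]) 2 = 0 := by
  set rk : Fin 4 → Fin 4 → ℕ := ![![0, 2, 1, 2], ![1, 0, 2, 0], ![0, 2, 2, 1], ![1, 0, 0, 2]]
    with hrk
  have hl := hf _ (isProfile_rankProfile rk)
  have hcd : f (rankProfile rk) 3 = f (rankProfile rk) 2 :=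
    apply_rankProfile_symm han hneu rk (Equiv.swap 2 3) (Equiv.swap 0 2 * Equiv.swap 1 3)
      (by decide) 2
  set t := f (rankProfile rk) 2 with ht
  have h0 : 0 ≤ t := hl.1 2
  have key := (heff _ (isProfile_rankProfile rk)).not_improvable (v := ![t, t, -t, -t]) hl
    (by simp [Fin.sum_univ_four]) (fun x => ?_) (fun i x => ?_) 0 0
  · simp [rankProfile, upperProb_pr, hrk] at key
    linarith
  · have := hl.1 x
    fin_cases x <;> simp at this ⊢ <;> linarith
  · fin_cases i <;> fin_cases x <;> simp [rankProfile, upperProb_pr, hrk, h0]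

theorem stmt6 (f : (Fin 4 → Fin 4 → Fin 4 → Prop) → (Fin 4 → ℝ))
    (hf : IsSDS f) (han : Anonymous f) (hneu : Neutral f)
    (heff : SDEfficient f) (hsp : SDStrategyproof f) :
    f R3 a ≤ 1/2 ∧ f R3 a + f R3 c ≤ 1/2 := by
  have hR3 : R3 = rankProfile ![![0, 2, 1, 2], ![1, 0, 2, 0], ![0, 2, 2, 1], ![1, 0, 0, 2]] := by
    funext i
    fin_cases i <;> rfl
  have hc : f R3 c = 0 := hR3 ▸ apply_R3_c_eq_zero hf han hneu heff
  suffices ha : f R3 a ≤ 1 / 2 from ⟨ha, by rw [hc]; linarith⟩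
  set P : (Fin 4 → ℕ) → (Fin 4 → ℕ) → Fin 4 → Fin 4 → Fin 4 → Prop := fun r s =>
    rankProfile ![![0, 1, 1, 1], r, ![0, 1, 1, 1], s] with hP
  have hprof : ∀ r s, IsProfile (P r s) := fun r s => isProfile_rankProfile _
  have hzero : ∀ r s : Fin 4 → ℕ, ∀ x, x ≠ 0 → r 1 ≤ r x → s 1 ≤ s x → (r 1 < r x ∨ s 1 < s x) →
      f (P r s) x = 0 := fun r s x hx hr hs hlt => by
    refine (heff _ (hprof r s)).eq_zero_of_dominated (hf _ (hprof r s)) (hprof r s) ⟨1, ?_, ?_⟩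
    · intro i
      fin_cases i <;> fin_cases x <;> simp_all [rankProfile, pr]
    · rcases hlt with h | h
      · exact ⟨1, hr, not_le.2 h⟩
      · exact ⟨3, hs, not_le.2 h⟩
  have htop : f R3 0 ≤ f (P ![1, 0, 2, 0] ![1, 0, 0, 2]) 0 := by
    rw [hR3]
    have hupd : Function.update (Function.update
        ![![0, 2, 1, 2], ![1, 0, 2, 0], ![0, 2, 2, 1], ![1, 0, 0, 2]] 0 ![0, 1, 1, 1]) 2
        ![0, 1, 1, 1] = ![![0, 1, 1, 1], ![1, 0, 2, 0], ![0, 1, 1, 1], ![1, 0, 0, 2]] := by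
      decide
    exact (hsp.le_of_top hf _ 0).trans ((hsp.le_of_top hf _ 2).trans_eq (by rw [hupd]))
  have hsum := fun r s => (hf _ (hprof r s)).add_eq_one
  have h1c := hzero ![1, 0, 2, 0] ![1, 0, 0, 2] 2 (by decide) (by decide) (by decide) (by decide)
  have h1d := hzero ![1, 0, 2, 0] ![1, 0, 0, 2] 3 (by decide) (by decide) (by decide) (by decide)
  have h2c := hzero ![1, 0, 1, 1] ![1, 0, 0, 2] 2 (by decide) (by decide) (by decide) (by decide)
  have h2d := hzero ![1, 0, 1, 1] ![1, 0, 0, 2] 3 (by decide) (by decide) (by decide) (by decide)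
  have h3c := hzero ![1, 0, 1, 1] ![1, 0, 1, 1] 2 (by decide) (by decide) (by decide) (by decide)
  have h3d := hzero ![1, 0, 1, 1] ![1, 0, 1, 1] 3 (by decide) (by decide) (by decide) (by decide)
  have s1 := hsum ![1, 0, 2, 0] ![1, 0, 0, 2]
  have s3 := hsum ![1, 0, 1, 1] ![1, 0, 1, 1]
  have hsymm : f (P ![1, 0, 1, 1] ![1, 0, 1, 1]) 1 = f (P ![1, 0, 1, 1] ![1, 0, 1, 1]) 0 :=
    apply_rankProfile_symm han hneu _ (Equiv.swap 0 1) (Equiv.swap 0 1 * Equiv.swap 2 3)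
      (by decide) 0
  have h12 : f (P ![1, 0, 1, 1] ![1, 0, 0, 2]) 1 ≤ f (P ![1, 0, 2, 0] ![1, 0, 0, 2]) 1 :=
    hsp.apply_one_le hf 1 (by decide) (by decide) h1c h1d h2c h2d
  have h23 : f (P ![1, 0, 1, 1] ![1, 0, 1, 1]) 1 ≤ f (P ![1, 0, 1, 1] ![1, 0, 0, 2]) 1 :=
    hsp.apply_one_le hf 3 (by decide) (by decide) h2c h2d h3c h3d
  change f R3 0 ≤ 1 / 2
  linarith
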